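/- Let {a_n}_{n≥0} be periodic with minimal period p ≥ 1, let {t_n} be a solution of t_{n+1} = e^{a_n}/t_n that is periodic with minimal period q ≥ 1 and t_0 > 0, and define g_k(x) = t_k·x·e^{−x} for k = 0, 1, …, q−1 and f = g_{q−1} ∘ g_{q−2} ∘ … ∘ g_1 ∘ g_0. If s ∈ (0,∞) satisfies f^{n+ω}(s) = f^n(s) for all n ≥ 0 (s is a periodic point of f of period ω), then the solution {x_n} of x_{n+1} = x_{n−1}·exp(a_n − x_{n−1} − x_n) with initial values x_{−1} = s and x_0 = g_0(s) = t_0·s·e^{−s} is periodic with period ωq: x_{n+ωq} = x_n for all n ≥ 0. -/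

import Mathlib

/- compDown g k = g k ∘ g (k-1) ∘ ... ∘ g 0 -/
def compDown (g : ℕ → ℝ → ℝ) : ℕ → (ℝ → ℝ)
  | 0 => g 0
  | k + 1 => g (k + 1) ∘ compDown g k

/-- An orbit of the nonautonomous system `Y (n + 1) = g n (Y n)` is advanced by `compDown`. -/
theorem compDown_apply_orbit {g : ℕ → ℝ → ℝ} {Y : ℕ → ℝ} (hY : ∀ n, Y (n + 1) = g n (Y n))
    (k : ℕ) : compDown g k (Y 0) = Y (k + 1) := by
  induction k with
  | zero => exact (hY 0).symm
  | succ k ih => rw [compDown, Function.comp_apply, ih, ← hY]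

/-- For a `q`-periodic system, the iterates of the one-period map sample the orbit at
multiples of `q`. -/
theorem iterate_compDown_orbit {g : ℕ → ℝ → ℝ} {Y : ℕ → ℝ} (hY : ∀ n, Y (n + 1) = g n (Y n))
    {q : ℕ} (hq : 1 ≤ q) (hg : Function.Periodic g q) (j : ℕ) :
    (compDown g (q - 1))^[j] (Y 0) = Y (j * q) := by
  induction j with
  | zero => simp
  | succ j ih =>
    have hshift : ∀ n, Y (n + 1 + j * q) = g n (Y (n + j * q)) := fun n => by
      rw [add_right_comm, hY, show g (n + j * q) = g n from hg.nat_mul j n]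
    have h := compDown_apply_orbit (Y := fun n => Y (n + j * q)) hshift (q - 1)
    rw [Nat.sub_add_cancel hq, zero_add] at h
    rw [Function.iterate_succ_apply', ih, h, Nat.succ_mul, add_comm]

/-- Solutions of the second-order equation satisfy the first-order factor equation. -/
theorem factor_equation {a t X : ℕ → ℝ} (ht0 : 0 < t 0)
    (htrec : ∀ n, t (n + 1) = Real.exp (a n) / t n)
    (hX1 : X 1 = t 0 * X 0 * Real.exp (-X 0))
    (hrec : ∀ n, X (n + 2) = X n * Real.exp (a n - X n - X (n + 1))) (n : ℕ) :
    X (n + 1) = t n * X n * Real.exp (-X n) := by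
  have htpos : ∀ n, 0 < t n := by
    intro n
    induction n with
    | zero => exact ht0
    | succ n ih => rw [htrec]; positivity
  induction n with
  | zero => exact hX1
  | succ n ih =>
    have hne := (htpos n).ne'
    have hexp : Real.exp (a n - X n - X (n + 1)) =
        Real.exp (a n) * Real.exp (-X n) * Real.exp (-X (n + 1)) := by
      rw [← Real.exp_add, ← Real.exp_add]; ring_nf
    have hmul : t (n + 1) * X (n + 1) = Real.exp (a n) * X n * Real.exp (-X n) := by
      rw [htrec, ih]; field_simp
    rw [hrec, hexp, hmul]; ring

/- Statement 13 (Lemma pq(a)): {a_n} periodic with minimal period p ≥ 1, {t_n} a solution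
of t_{n+1} = e^{a_n}/t_n, periodic with minimal period q ≥ 1, t_0 > 0.  With
g_k(x) = t_k x e^{-x} and f = g_{q-1} ∘ ... ∘ g_0, if s ∈ (0,∞) satisfies
f^[n+ω](s) = f^[n](s) for all n (a periodic point of period ω), then the solution of (E)
with x_{-1} = s and x_0 = t_0 s e^{-s} satisfies x_{n+ωq} = x_n for all n ≥ 0.
We index X : ℕ → ℝ with X n = x_{n-1}, so the conclusion reads
X (n+1+ωq) = X (n+1) for all n. -/
theorem stmt_13 (a : ℕ → ℝ) (p : ℕ) (hp : 1 ≤ p) (hper : Function.Periodic a p)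
    (hmin : ∀ r : ℕ, 0 < r → Function.Periodic a r → p ≤ r)
    (t : ℕ → ℝ) (ht0 : 0 < t 0)
    (htrec : ∀ n : ℕ, t (n + 1) = Real.exp (a n) / t n)
    (q : ℕ) (hq : 1 ≤ q) (htq : ∀ n : ℕ, t (n + q) = t n)
    (htqmin : ∀ r : ℕ, 0 < r → (∀ n : ℕ, t (n + r) = t n) → q ≤ r)
    (f : ℝ → ℝ) (hf : f = compDown (fun k x => t k * x * Real.exp (-x)) (q - 1))
    (s : ℝ) (hs : 0 < s) (ω : ℕ) (hω : 0 < ω)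
    (hsper : ∀ n : ℕ, f^[n + ω] s = f^[n] s)
    (X : ℕ → ℝ) (hX0 : X 0 = s) (hX1 : X 1 = t 0 * s * Real.exp (-s))
    (hrec : ∀ n : ℕ, X (n + 2) = X n * Real.exp (a n - X n - X (n + 1))) :
    ∀ n : ℕ, X (n + 1 + ω * q) = X (n + 1) := by
  subst hX0 hf
  have hstep := factor_equation ht0 htrec hX1 hrec
  have hg : Function.Periodic (fun (k : ℕ) (x : ℝ) => t k * x * Real.exp (-x)) q := fun k => by
    simp only [htq k]
  have hbase : X (ω * q) = X 0 := by
    rw [← iterate_compDown_orbit hstep hq hg ω]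
    simpa using hsper 0
  have hperiodic : ∀ n, X (n + ω * q) = X n := by
    intro n
    induction n with
    | zero => rwa [zero_add]
    | succ n ih =>
      have htn : t (n + ω * q) = t n := Function.Periodic.nat_mul (f := t) htq ω n
      rw [add_right_comm, hstep, ih, htn, ← hstep]
  exact fun n => hperiodic (n + 1)
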